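/- arXiv:2512.24982 — 5 statements merged into one kernel-verified Lean document; each statement's English description precedes it below -/
import Mathlib

section
/- For every n×n matrix A over a field F, there exist finitely many monic polynomials f₁, …, f_k ∈ F[x], each of the form qᵐ with q a monic irreducible polynomial and m ≥ 1, together with an invertible n×n matrix S over F, such that S·A·S⁻¹ equals the block-diagonal matrix whose diagonal blocks are the companion matrices C_{f₁}, …, C_{f_k} (in particular, the degrees of the fᵢ sum to n). -/
open Polynomial Matrix

/-- The companion matrix of a monic polynomial `f` of degree `d`:
ones in positions `(i+1, i)` for `0 ≤ i < d-1`, last column has entry `-(coeff j)` in row `j`,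
and zeros elsewhere. -/
def companionMatrix {F : Type*} [Field F] (d : ℕ) (f : Polynomial F) :
    Matrix (Fin d) (Fin d) F :=
  Matrix.of fun i j =>
    if (i : ℕ) = (j : ℕ) + 1 then 1
    else if (j : ℕ) = d - 1 then -(f.coeff (i : ℕ)) else 0

universe u

/-- The powers of `X` form a basis of `F[X] ⧸ (f)`, and multiplication by `X` acts on it through
the companion matrix of `f`. -/
theorem exists_basis_quotient_X_smul {F : Type*} [Field F] {f : F[X]} (hf : f.Monic) :
    ∃ b : Module.Basis (Fin f.natDegree) F (F[X] ⧸ Submodule.span F[X] {f}),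
      ∀ j, (X : F[X]) • b j = ∑ l, companionMatrix f.natDegree f l j • b l := by
  let b₀ : Module.Basis (Fin f.natDegree) F (AdjoinRoot f) := AdjoinRoot.powerBasisAux' hf
  have hb₀ (i) : b₀ i = AdjoinRoot.root f ^ (i : ℕ) := (AdjoinRoot.powerBasis' hf).basis_eq_pow i
  have key : ∀ j, AdjoinRoot.root f * b₀ j =
      ∑ l, companionMatrix f.natDegree f l j • b₀ l := by
    intro j
    simp only [hb₀, ← pow_succ', companionMatrix, Matrix.of_apply]
    by_cases hj : (j : ℕ) = f.natDegree - 1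
    · have hj' : (j : ℕ) + 1 = f.natDegree := by omega
      have hroot : aeval (AdjoinRoot.root f) f = 0 := by simp
      rw [aeval_eq_sum_range, Finset.sum_range_succ, hf.coeff_natDegree, one_smul,
        Finset.sum_range] at hroot
      rw [hj', eq_neg_of_add_eq_zero_right hroot, ← Finset.sum_neg_distrib]
      refine Finset.sum_congr rfl fun l _ => ?_
      rw [if_neg (by omega), if_pos hj, neg_smul]
    · rw [Finset.sum_eq_single ⟨j + 1, by omega⟩]
      · simp
      · intro l _ hl
        have : (l : ℕ) ≠ j + 1 := fun h => hl (Fin.ext h)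
        simp [this, hj]
      · simp
  refine ⟨b₀, fun j => ?_⟩
  have hX (v : F[X] ⧸ Submodule.span F[X] {f}) (w : AdjoinRoot f) (h : v = w) :
      (X : F[X]) • v = AdjoinRoot.root f * w := by
    subst h
    obtain ⟨p, rfl⟩ := Submodule.Quotient.mk_surjective _ v
    rfl
  exact (hX _ _ rfl).trans (key j)

/-- The polynomial `X` acts on the direct sum of the cyclic modules `F[X] ⧸ (f i)` through the
block-diagonal matrix of companion matrices. -/
theorem exists_basis_directSum_X_smul {F ι : Type*} [Field F] (f : ι → F[X])
    (hf : ∀ i, (f i).Monic) :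
    ∃ b : Module.Basis (Σ i, Fin (f i).natDegree) F
        (DirectSum ι fun i => F[X] ⧸ Submodule.span F[X] {f i}),
      ∀ i j, (X : F[X]) • b ⟨i, j⟩ =
        ∑ l, companionMatrix (f i).natDegree (f i) l j • b ⟨i, l⟩ := by
  classical
  choose c hc using fun i => exists_basis_quotient_X_smul (hf i)
  let b : Module.Basis (Σ i, Fin (f i).natDegree) F
    (DirectSum ι fun i => F[X] ⧸ Submodule.span F[X] {f i}) := DFinsupp.basis c
  have hb (i j) : b ⟨i, j⟩ = DirectSum.lof F ι (fun i => F[X] ⧸ Submodule.span F[X] {f i}) i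
      (c i j) := by
    have hrepr (v i l) : b.repr v ⟨i, l⟩ = (c i).repr (v i) l := rfl
    refine b.repr.injective (Finsupp.ext ?_)
    rintro ⟨i', l⟩
    rw [Module.Basis.repr_self, hrepr]
    by_cases h : i = i'
    · subst h
      simp [DirectSum.lof_apply, Finsupp.single_apply]
    · rw [DirectSum.lof_eq_of, DirectSum.of_eq_of_ne _ _ _ (Ne.symm h)]
      simp [h]
  refine ⟨b, fun i j => ?_⟩
  simp only [hb, ← map_smul, ← map_sum]
  rw [← hc]
  exact (map_smul (DirectSum.lof F[X] ι (fun i => F[X] ⧸ Submodule.span F[X] {f i}) i) X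
    (c i j)).symm

/-- Every endomorphism of a finite-dimensional space is, in a suitable basis, block-diagonal with
companion matrices of (possibly trivial) powers of monic irreducible polynomials as blocks. -/
theorem exists_basis_companionMatrix {F : Type u} {V : Type*} [Field F] [AddCommGroup V]
    [Module F V] [FiniteDimensional F V] (φ : Module.End F V) :
    ∃ (ι : Type u) (_ : Fintype ι) (f : ι → F[X]),
      (∀ i, ∃ (q : F[X]) (m : ℕ), q.Monic ∧ Irreducible q ∧ f i = q ^ m) ∧
      ∃ b : Module.Basis (Σ i, Fin (f i).natDegree) F V, ∀ i j,
        φ (b ⟨i, j⟩) = ∑ l, companionMatrix (f i).natDegree (f i) l j • b ⟨i, l⟩ := by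
  classical
  obtain ⟨ι, _, p, hp, e, ⟨L⟩⟩ := Module.equiv_directSum_of_isTorsion
    (Module.AEval.isTorsion_of_finiteDimensional F V φ)
  have hspan (i) : Submodule.span F[X] {p i ^ e i} =
      Submodule.span F[X] {normalize (p i) ^ e i} :=
    Ideal.span_singleton_eq_span_singleton.2 ((normalize_associated (p i)).symm.pow_pow)
  have hmon (i) : (normalize (p i)).Monic := monic_normalize (hp i).ne_zero
  obtain ⟨b, hb⟩ := exists_basis_directSum_X_smul (fun i => normalize (p i) ^ e i)
    fun i => (hmon i).pow _
  let L' := L.trans (DFinsupp.mapRange.linearEquiv fun i => Submodule.quotEquivOfEq _ _ (hspan i))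
  refine ⟨ι, inferInstance, fun i => normalize (p i) ^ e i,
    fun i => ⟨_, _, hmon i, (normalize_associated (p i)).symm.irreducible (hp i), rfl⟩,
    b.map ((L'.restrictScalars F).symm.trans (Module.AEval.of F V φ).symm), fun i j => ?_⟩
  have h := congrArg (fun v => (Module.AEval.of F V φ).symm ((L'.restrictScalars F).symm v)) (hb i j)
  simp only [map_sum, map_smul] at h
  refine Eq.trans ?_ h
  change φ ((Module.AEval.of F V φ).symm (L'.symm _)) =
    (Module.AEval.of F V φ).symm (L'.symm (_ • _))
  rw [map_smul, Module.AEval.of_symm_X_smul]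
  rfl

/-- Every endomorphism of a finite-dimensional space is, in a suitable basis, block-diagonal with
companion matrices of positive powers of monic irreducible polynomials as blocks. -/
theorem exists_basis_companionMatrix_fin {F V : Type*} [Field F] [AddCommGroup V]
    [Module F V] [FiniteDimensional F V] (φ : Module.End F V) :
    ∃ (k : ℕ) (f : Fin k → F[X]),
      (∀ i, ∃ (q : F[X]) (m : ℕ), q.Monic ∧ Irreducible q ∧ 1 ≤ m ∧ f i = q ^ m) ∧
      ∃ b : Module.Basis (Σ i, Fin (f i).natDegree) F V, ∀ i j,
        φ (b ⟨i, j⟩) = ∑ l, companionMatrix (f i).natDegree (f i) l j • b ⟨i, l⟩ := by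
  classical
  obtain ⟨ι, _, f, hf, b, hb⟩ := exists_basis_companionMatrix φ
  let g := (Fintype.equivFin {i // f i ≠ 1}).symm
  have hσ : Function.Bijective (Sigma.map (fun a => (g a : ι)) (fun _ => id) :
      (Σ a, Fin (f (g a)).natDegree) → Σ i, Fin (f i).natDegree) := by
    constructor
    · exact (Subtype.val_injective.comp g.injective).sigma_map fun _ => Function.injective_id
    · rintro ⟨i, j⟩
      have hi : f i ≠ 1 := by
        intro h
        have := j.2
        simp [h] at this
      obtain ⟨a, ha⟩ := g.surjective ⟨i, hi⟩
      obtain rfl : (g a : ι) = i := congrArg Subtype.val ha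
      exact ⟨⟨a, j⟩, rfl⟩
  refine ⟨_, fun a => f (g a), fun a => ?_, b.reindex (Equiv.ofBijective _ hσ).symm, fun i j => ?_⟩
  · obtain ⟨q, m, hq, hirr, h⟩ := hf (g a)
    refine ⟨q, m, hq, hirr, Nat.one_le_iff_ne_zero.2 ?_, h⟩
    rintro rfl
    exact (g a).2 (by simpa using h)
  · simpa [Sigma.map] using hb (g i) j

/-- **Generalized Jordan normal form.** Every `n × n` matrix `A` over a field `F` is similar to
a block-diagonal matrix of companion matrices of finitely many monic polynomials, each of which
is a positive power of a monic irreducible polynomial (and whose degrees sum to `n`, as witnessed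
by the index equivalence). -/
theorem generalized_jordan_normal_form {F : Type*} [Field F] (n : ℕ)
    (A : Matrix (Fin n) (Fin n) F) :
    ∃ (k : ℕ) (d : Fin k → ℕ) (f : Fin k → Polynomial F),
      (∀ i, (f i).Monic ∧ (f i).natDegree = d i ∧
        ∃ (q : Polynomial F) (m : ℕ), q.Monic ∧ Irreducible q ∧ 1 ≤ m ∧ f i = q ^ m) ∧
      ∃ (e : (Σ i : Fin k, Fin (d i)) ≃ Fin n) (S : Matrix (Fin n) (Fin n) F),
        IsUnit S ∧
        S * A * S⁻¹ =
          Matrix.reindex e e (Matrix.blockDiagonal' fun i => companionMatrix (d i) (f i)) := by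
  obtain ⟨k, f, hf, b, hb⟩ := exists_basis_companionMatrix_fin (Matrix.toLin' A)
  have hmonic (i) : (f i).Monic := by
    obtain ⟨q, m, hq, -, -, h⟩ := hf i
    exact h ▸ hq.pow m
  let s := Pi.basisFun F (Fin n)
  let e := b.indexEquiv s
  let c := b.reindex e
  refine ⟨k, fun i => (f i).natDegree, f, fun i => ⟨hmonic i, rfl, hf i⟩, e, c.toMatrix s, ?_, ?_⟩
  · exact IsUnit.of_mul_eq_one _ (c.toMatrix_mul_toMatrix_flip s)
  · rw [Matrix.inv_eq_right_inv (c.toMatrix_mul_toMatrix_flip s)]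
    have hA : A = LinearMap.toMatrix s s (Matrix.toLin' A) :=
      (LinearMap.toMatrix'_toLin' A).symm
    conv_lhs => rw [hA]
    rw [basis_toMatrix_mul_linearMap_toMatrix_mul_basis_toMatrix]
    ext x y
    obtain ⟨⟨i, j⟩, rfl⟩ := e.surjective x
    obtain ⟨⟨i', j'⟩, rfl⟩ := e.surjective y
    rw [LinearMap.toMatrix_apply]
    simp only [c, Module.Basis.reindex_apply, Equiv.symm_apply_apply, hb,
      Matrix.reindex_apply, Matrix.submatrix_apply, map_sum, map_smul]
    rw [Finsupp.finsetSum_apply]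
    by_cases h : i = i'
    · subst h
      simp [Finsupp.single_apply, Matrix.blockDiagonal'_apply]
    · simp [Matrix.blockDiagonal'_apply, h]
end

section
/- Let F be a field and let A be an n×n matrix over F. If A is similar to the block-diagonal matrix of companion matrices of the monic polynomials in a finite multiset S, each polynomial in S being of the form qᵐ with q monic irreducible and m ≥ 1, and A is also similar to the block-diagonal matrix of companion matrices of another such multiset S′, then S = S′ as multisets. -/
open Polynomial Matrix

section BlockDiagonal

variable {F ι : Type*} [Field F] [Fintype ι] [DecidableEq ι] {m : ι → Type*}
  [∀ i, Fintype (m i)]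

theorem Matrix.blockDiagonal'_mulVec_apply (M : ∀ i, Matrix (m i) (m i) F)
    (v : (Σ i, m i) → F) (s : Σ i, m i) :
    (blockDiagonal' M *ᵥ v) s = (M s.1 *ᵥ fun b => v ⟨s.1, b⟩) s.2 := by
  obtain ⟨i, a⟩ := s
  simp only [mulVec, dotProduct, Fintype.sum_sigma]
  rw [Finset.sum_eq_single i]
  · simp
  · intro j _ hj
    simp [blockDiagonal'_apply_ne _ _ _ hj.symm]
  · simp

/-- The kernel of a block diagonal matrix is the product of the kernels of its blocks. -/
def Matrix.kerBlockDiagonal'Equiv (M : ∀ i, Matrix (m i) (m i) F) :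
    LinearMap.ker (blockDiagonal' M).mulVecLin ≃ₗ[F] ∀ i, LinearMap.ker (M i).mulVecLin where
  toFun v i := ⟨fun b => v.1 ⟨i, b⟩, by
    ext a
    have h := congrFun (LinearMap.mem_ker.1 v.2) ⟨i, a⟩
    rwa [mulVecLin_apply, blockDiagonal'_mulVec_apply] at h⟩
  invFun w := ⟨fun s => (w s.1).1 s.2, by
    ext s
    rw [mulVecLin_apply, blockDiagonal'_mulVec_apply]
    exact congrFun (LinearMap.mem_ker.1 (w s.1).2) s.2⟩
  map_add' _ _ := rfl
  map_smul' _ _ := rfl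
  left_inv _ := rfl
  right_inv _ := rfl

theorem Matrix.rank_blockDiagonal' (M : ∀ i, Matrix (m i) (m i) F) :
    (blockDiagonal' M).rank = ∑ i, (M i).rank := by
  have hker : Module.finrank F (LinearMap.ker (blockDiagonal' M).mulVecLin) =
      ∑ i, Module.finrank F (LinearMap.ker (M i).mulVecLin) := by
    rw [(kerBlockDiagonal'Equiv M).finrank_eq, Module.finrank_pi_fintype]
  have h := (blockDiagonal' M).mulVecLin.finrank_range_add_finrank_ker
  have h' := fun i => (M i).mulVecLin.finrank_range_add_finrank_ker
  have hs := Finset.sum_congr rfl fun i (_ : i ∈ Finset.univ) => h' i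
  rw [Finset.sum_add_distrib] at hs
  simp only [Module.finrank_fintype_fun_eq_card, Fintype.card_sigma] at h hs
  simp only [rank]
  omega

variable [∀ i, DecidableEq (m i)]

/-- `Matrix.blockDiagonal'RingHom` as an algebra homomorphism. -/
def Matrix.blockDiagonal'AlgHom : (∀ i, Matrix (m i) (m i) F) →ₐ[F]
    Matrix (Σ i, m i) (Σ i, m i) F :=
  AlgHom.ofLinearMap
    { toFun := blockDiagonal'
      map_add' := blockDiagonal'_add
      map_smul' := blockDiagonal'_smul }
    blockDiagonal'_one blockDiagonal'_mul

theorem Matrix.aeval_blockDiagonal' (M : ∀ i, Matrix (m i) (m i) F) (p : F[X]) :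
    aeval (blockDiagonal' M) p = blockDiagonal' fun i => aeval (M i) p := by
  have h := aeval_algHom_apply (blockDiagonal'AlgHom (F := F) (m := m)) M p
  refine h.trans (congrArg blockDiagonal' ?_)
  ext1 i
  exact (aeval_algHom_apply (Pi.evalAlgHom F _ i) M p).symm

end BlockDiagonal

section Companion

variable {F : Type*} [Field F]

theorem PowerBasis.companionMatrix_minpolyGen {R : Type*} [CommRing R] [Algebra F R]
    (pb : PowerBasis F R) :
    companionMatrix pb.dim pb.minpolyGen = Algebra.leftMulMatrix pb.basis pb.gen := by
  rw [pb.leftMulMatrix]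
  ext i j
  have hi := i.2
  have hj := j.2
  simp only [companionMatrix, of_apply]
  split_ifs <;> first | rfl | omega

theorem PowerBasis.rank_aeval_companionMatrix {R : Type*} [CommRing R] [Algebra F R]
    (pb : PowerBasis F R) (p : F[X]) :
    (aeval (companionMatrix pb.dim pb.minpolyGen) p).rank =
      Module.finrank F (LinearMap.range (Algebra.lmul F R (aeval pb.gen p))) := by
  rw [pb.companionMatrix_minpolyGen, aeval_algHom_apply, Algebra.leftMulMatrix_apply,
    rank_eq_finrank_range_toLin _ pb.basis pb.basis, Matrix.toLin_toMatrix]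

/-- The rank of `p` evaluated at the companion matrix of `f`, in terms of `F[X] ⧸ (f, p)`. -/
theorem rank_aeval_companionMatrix_add {f : F[X]} (hf : f.Monic) (p : F[X]) :
    (aeval (companionMatrix f.natDegree f) p).rank +
      Module.finrank F (F[X] ⧸ (Ideal.span {f} ⊔ Ideal.span {p})) = f.natDegree := by
  have hrank := (AdjoinRoot.powerBasis' hf).rank_aeval_companionMatrix p
  have hmin : (AdjoinRoot.powerBasis' hf).minpolyGen = f := by
    rw [PowerBasis.minpolyGen_eq, AdjoinRoot.powerBasis'_gen, AdjoinRoot.minpoly_root hf.ne_zero,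
      hf.leadingCoeff]
    simp
  rw [hmin, AdjoinRoot.powerBasis'_gen, AdjoinRoot.aeval_eq] at hrank
  have hfin : Module.Finite F (F[X] ⧸ Ideal.span {f}) := hf.finite_adjoinRoot
  have hrange : LinearMap.range (Algebra.lmul F (F[X] ⧸ Ideal.span {f}) (Ideal.Quotient.mk _ p)) =
      ((Ideal.span {p}).map (Ideal.Quotient.mkₐ F (Ideal.span {f}))).restrictScalars F := by
    ext x
    rw [Submodule.restrictScalars_mem, Ideal.map_span, Set.image_singleton,
      Ideal.mem_span_singleton']
    exact exists_congr fun y => by rw [mul_comm]; rfl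
  have hadd := Submodule.finrank_quotient_add_finrank
    (((Ideal.span {p}).map (Ideal.Quotient.mkₐ F (Ideal.span {f}))).restrictScalars F)
  rw [finrank_quotient_span_eq_natDegree,
    (Submodule.Quotient.restrictScalarsEquiv F _).finrank_eq, ← hrange] at hadd
  rw [← (DoubleQuot.quotQuotEquivQuotSupₐ F (Ideal.span {f})
    (Ideal.span {p})).toLinearEquiv.finrank_eq, add_comm]
  exact (congrArg _ hrank).trans hadd

end Companion

section PrimePower

variable {F : Type*} [Field F]

theorem finrank_quotient_sup_pow_same {q : F[X]} (a b : ℕ) :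
    Module.finrank F (F[X] ⧸ (Ideal.span {q ^ a} ⊔ Ideal.span {q ^ b})) =
      min a b * q.natDegree := by
  rw [← natDegree_pow, ← finrank_quotient_span_eq_natDegree]
  rcases le_total a b with h | h
  · rw [min_eq_left h, sup_eq_left.2 (Ideal.span_singleton_le_span_singleton.2 (pow_dvd_pow q h))]
  · rw [min_eq_right h, sup_eq_right.2 (Ideal.span_singleton_le_span_singleton.2 (pow_dvd_pow q h))]

theorem finrank_quotient_sup_of_isCoprime {p q : F[X]} (h : IsCoprime p q) :
    Module.finrank F (F[X] ⧸ (Ideal.span {p} ⊔ Ideal.span {q})) = 0 := by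
  rw [(Ideal.isCoprime_span_singleton_iff p q).2 h |>.sup_eq]
  exact Module.finrank_zero_of_subsingleton

theorem isCoprime_of_irreducible_of_monic_of_ne {p q : F[X]} (hp : Irreducible p)
    (hpm : p.Monic) (hq : Irreducible q) (hqm : q.Monic) (h : p ≠ q) : IsCoprime p q :=
  hp.coprime_iff_not_dvd.2 fun hdvd =>
    h (eq_of_monic_of_associated hpm hqm (hp.associated_of_dvd hq hdvd))

/-- The second difference of `a ↦ dim F[X] ⧸ (r ^ e, q ^ a)` at `a = m + 1` detects whether
`r ^ e` equals `q ^ (m + 1)`. -/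
theorem finrank_quotient_sup_second_difference [DecidableEq F[X]] {q r : F[X]} (hq : Irreducible q)
    (hqm : q.Monic) (hr : Irreducible r) (hrm : r.Monic) (m : ℕ) {e : ℕ} (he : 1 ≤ e) :
    (if r ^ e = q ^ (m + 1) then q.natDegree else 0) +
      (Module.finrank F (F[X] ⧸ (Ideal.span {r ^ e} ⊔ Ideal.span {q ^ m})) +
      Module.finrank F (F[X] ⧸ (Ideal.span {r ^ e} ⊔ Ideal.span {q ^ (m + 2)}))) =
      2 * Module.finrank F (F[X] ⧸ (Ideal.span {r ^ e} ⊔ Ideal.span {q ^ (m + 1)})) := by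
  by_cases h : r = q
  · subst h
    have hpow : r ^ e = r ^ (m + 1) ↔ e = m + 1 := by
      refine ⟨fun h => ?_, fun h => h ▸ rfl⟩
      have := congrArg natDegree h
      rw [natDegree_pow, natDegree_pow] at this
      exact Nat.eq_of_mul_eq_mul_right hr.natDegree_pos this
    simp only [finrank_quotient_sup_pow_same, hpow]
    rcases lt_trichotomy e (m + 1) with h | h | h
    · rw [if_neg h.ne, min_eq_left (by omega), min_eq_left (by omega), min_eq_left (by omega)]
      ring
    · subst h
      rw [if_pos rfl, min_eq_right (by omega), min_eq_left (by omega), min_self]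
      ring
    · rw [if_neg h.ne', min_eq_right (by omega), min_eq_right (by omega), min_eq_right (by omega)]
      ring
  · have hcop := isCoprime_of_irreducible_of_monic_of_ne hr hrm hq hqm h
    have hne : r ^ e ≠ q ^ (m + 1) := fun heq =>
      hr.not_isUnit (IsCoprime.isUnit_of_dvd' hcop dvd_rfl
        (hr.prime.dvd_of_dvd_pow (heq ▸ dvd_pow_self r (by omega))))
    simp [finrank_quotient_sup_of_isCoprime hcop.pow, hne]

end PrimePower

section Count

variable {F : Type*} [Field F]

theorem rank_aeval_of_similar_blockDiagonal' {n k : ℕ} {A : Matrix (Fin n) (Fin n) F}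
    {d : Fin k → ℕ} {f : Fin k → F[X]} (hf : ∀ i, (f i).Monic ∧ (f i).natDegree = d i)
    (hA : ∃ (e : (Σ i : Fin k, Fin (d i)) ≃ Fin n) (S : Matrix (Fin n) (Fin n) F), IsUnit S ∧
      A = S * reindex e e (blockDiagonal' fun i => companionMatrix (d i) (f i)) * S⁻¹)
    (p : F[X]) :
    (aeval A p).rank +
      ∑ i, Module.finrank F (F[X] ⧸ (Ideal.span {f i} ⊔ Ideal.span {p})) = n := by
  obtain rfl : (fun i => (f i).natDegree) = d := funext fun i => (hf i).2
  obtain ⟨e, S, hS, rfl⟩ := hA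
  have hn : ∑ i, (f i).natDegree = n := by simpa using Fintype.card_congr e
  obtain ⟨u, rfl⟩ := hS
  set B := blockDiagonal' fun i => companionMatrix (f i).natDegree (f i) with hB
  have hconj : aeval (u.val * reindex e e B * u.val⁻¹) p =
      u.val * reindex e e (aeval B p) * u.val⁻¹ := by
    rw [← coe_units_inv, ← coe_reindexAlgEquiv F F, ← aeval_algHom_apply,
      aeval_eq_sum_range, aeval_eq_sum_range, Finset.mul_sum, Finset.sum_mul]
    simp only [Units.conj_pow, mul_smul_comm, smul_mul_assoc]
  have hdet : IsUnit u.val.det := (isUnit_iff_isUnit_det _).1 u.isUnit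
  rw [hconj, rank_mul_eq_left_of_isUnit_det _ _ (isUnit_nonsing_inv_det _ hdet),
    rank_mul_eq_right_of_isUnit_det _ _ hdet, rank_reindex, hB, aeval_blockDiagonal',
    rank_blockDiagonal', ← Finset.sum_add_distrib, ← hn]
  exact Finset.sum_congr rfl fun i _ => rank_aeval_companionMatrix_add (hf i).1 p

theorem natDegree_mul_count_add [DecidableEq F[X]] {k : ℕ} {f : Fin k → F[X]}
    (hf : ∀ i, ∃ (q : F[X]) (m : ℕ), q.Monic ∧ Irreducible q ∧ 1 ≤ m ∧ f i = q ^ m)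
    {q : F[X]} (hq : Irreducible q) (hqm : q.Monic) (m : ℕ) :
    Multiset.count (q ^ (m + 1)) (List.ofFn f : Multiset F[X]) * q.natDegree +
      (∑ i, Module.finrank F (F[X] ⧸ (Ideal.span {f i} ⊔ Ideal.span {q ^ m})) +
      ∑ i, Module.finrank F (F[X] ⧸ (Ideal.span {f i} ⊔ Ideal.span {q ^ (m + 2)}))) =
      2 * ∑ i, Module.finrank F (F[X] ⧸ (Ideal.span {f i} ⊔ Ideal.span {q ^ (m + 1)})) := by
  have hcount : Multiset.count (q ^ (m + 1)) (List.ofFn f : Multiset F[X]) * q.natDegree =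
      ∑ i, if f i = q ^ (m + 1) then q.natDegree else 0 := by
    rw [← Fin.univ_val_map, Multiset.count_map, ← Finset.filter_val, Finset.card_val,
      ← Finset.sum_filter, Finset.sum_const, smul_eq_mul]
    simp only [eq_comm]
  rw [hcount, ← Finset.sum_add_distrib, ← Finset.sum_add_distrib, Finset.mul_sum]
  refine Finset.sum_congr rfl fun i _ => ?_
  obtain ⟨r, e, hrm, hr, he, hi⟩ := hf i
  rw [hi]
  exact finrank_quotient_sup_second_difference hq hqm hr hrm m he

end Count

/-- **Uniqueness of the generalized Jordan normal form.** If an `n × n` matrix `A` over a field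
is similar both to the block diagonal of companion matrices of the prime-power monic polynomials
`f i` and to that of the prime-power monic polynomials `g i`, then the two multisets of
polynomials coincide. -/
theorem generalized_jordan_normal_form_unique {F : Type*} [Field F] (n : ℕ)
    (A : Matrix (Fin n) (Fin n) F)
    {k l : ℕ} (d : Fin k → ℕ) (f : Fin k → Polynomial F)
    (d' : Fin l → ℕ) (g : Fin l → Polynomial F)
    (hf : ∀ i, (f i).Monic ∧ (f i).natDegree = d i ∧
      ∃ (q : Polynomial F) (m : ℕ), q.Monic ∧ Irreducible q ∧ 1 ≤ m ∧ f i = q ^ m)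
    (hg : ∀ i, (g i).Monic ∧ (g i).natDegree = d' i ∧
      ∃ (q : Polynomial F) (m : ℕ), q.Monic ∧ Irreducible q ∧ 1 ≤ m ∧ g i = q ^ m)
    (hAf : ∃ (e : (Σ i : Fin k, Fin (d i)) ≃ Fin n) (S : Matrix (Fin n) (Fin n) F),
      IsUnit S ∧
      A = S * Matrix.reindex e e (Matrix.blockDiagonal' fun i => companionMatrix (d i) (f i))
            * S⁻¹)
    (hAg : ∃ (e : (Σ i : Fin l, Fin (d' i)) ≃ Fin n) (S : Matrix (Fin n) (Fin n) F),
      IsUnit S ∧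
      A = S * Matrix.reindex e e (Matrix.blockDiagonal' fun i => companionMatrix (d' i) (g i))
            * S⁻¹) :
    (List.ofFn f : Multiset (Polynomial F)) = (List.ofFn g : Multiset (Polynomial F)) := by
  classical
  have hsum (p : F[X]) :
      ∑ i, Module.finrank F (F[X] ⧸ (Ideal.span {f i} ⊔ Ideal.span {p})) =
      ∑ i, Module.finrank F (F[X] ⧸ (Ideal.span {g i} ⊔ Ideal.span {p})) := by
    have h₁ := rank_aeval_of_similar_blockDiagonal' (fun i => ⟨(hf i).1, (hf i).2.1⟩) hAf p
    have h₂ := rank_aeval_of_similar_blockDiagonal' (fun i => ⟨(hg i).1, (hg i).2.1⟩) hAg p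
    omega
  have hcount {q : F[X]} (hqm : q.Monic) (hq : Irreducible q) {m : ℕ} (hm : 1 ≤ m) :
      Multiset.count (q ^ m) (List.ofFn f : Multiset F[X]) =
      Multiset.count (q ^ m) (List.ofFn g : Multiset F[X]) := by
    obtain ⟨m, rfl⟩ := Nat.exists_eq_add_of_le' hm
    have h₁ := natDegree_mul_count_add (fun i => (hf i).2.2) hq hqm m
    have h₂ := natDegree_mul_count_add (fun i => (hg i).2.2) hq hqm m
    simp only [hsum] at h₁
    exact Nat.eq_of_mul_eq_mul_right hq.natDegree_pos (by omega)
  ext p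
  by_cases hp : ∃ (q : F[X]) (m : ℕ), q.Monic ∧ Irreducible q ∧ 1 ≤ m ∧ p = q ^ m
  · obtain ⟨q, m, hqm, hq, hm, rfl⟩ := hp
    exact hcount hqm hq hm
  · rw [Multiset.count_eq_zero.2, Multiset.count_eq_zero.2]
    · rw [Multiset.mem_coe, List.mem_ofFn]
      rintro ⟨i, rfl⟩
      exact hp (hg i).2.2
    · rw [Multiset.mem_coe, List.mem_ofFn]
      rintro ⟨i, rfl⟩
      exact hp (hf i).2.2
end

section
/- For every n ≥ 1 and every n×n matrix A over a field F, there exists an invertible n×n matrix S over F such that the matrix S·A·S⁻¹ has at most 2n − 1 nonzero entries. In other words, every square matrix over a field is similar to a sparse matrix. -/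
open Matrix

open scoped Polynomial

theorem exists_basis_quotient_X_smul_s2 {F : Type*} [Field F] {g : F[X]} (hg : g ≠ 0) :
    ∃ (d : ℕ) (c : Module.Basis (Fin d) F (F[X] ⧸ Submodule.span F[X] {g})),
      ∀ (j : Fin d) (h : j.1 + 1 < d), (Polynomial.X : F[X]) • c j = c ⟨j.1 + 1, h⟩ := by
  let c : Module.Basis (Fin g.natDegree) F (F[X] ⧸ Submodule.span F[X] {g}) :=
    (AdjoinRoot.powerBasis hg).basis
  have hc : ∀ j, c j = Submodule.Quotient.mk (Polynomial.X ^ j.1) := fun j ↦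
    (AdjoinRoot.powerBasis hg).basis_eq_pow j
  refine ⟨g.natDegree, c, fun j h ↦ ?_⟩
  rw [hc, hc, ← Submodule.Quotient.mk_smul, smul_eq_mul, pow_succ']

/-- A cyclic decomposition of an endomorphism, expressed in coordinates. -/
theorem exists_basis_cyclic_decomposition.{u, v} {F : Type u} {V : Type v} [Field F] [AddCommGroup V] [Module F V]
    [FiniteDimensional F V] (f : Module.End F V) :
    ∃ (ι : Type u) (_ : Fintype ι) (d : ι → ℕ) (b : Module.Basis (Σ i, Fin (d i)) F V),
      (∀ i (j : Fin (d i)) (h : j.1 + 1 < d i), f (b ⟨i, j⟩) = b ⟨i, j.1 + 1, h⟩) ∧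
      ∀ i (j : Fin (d i)) k (l : Fin (d k)), k ≠ i → b.repr (f (b ⟨i, j⟩)) ⟨k, l⟩ = 0 := by
  classical
  obtain ⟨ι, _, p, hp, e, ⟨E⟩⟩ := Module.equiv_directSum_of_isTorsion
    (Module.AEval.isTorsion_of_finiteDimensional F V f)
  choose d c hc using fun i ↦ exists_basis_quotient_X_smul_s2 (pow_ne_zero (e i) (hp i).ne_zero)
  let E' := E.trans (DirectSum.linearEquivFunOnFintype F[X] ι _)
  let T : V ≃ₗ[F] _ := (Module.AEval'.of f).trans (E'.restrictScalars F)
  have hT : ∀ v, T (f v) = (Polynomial.X : F[X]) • T v := fun v ↦ by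
    simp only [T, LinearEquiv.trans_apply, LinearEquiv.restrictScalars_apply,
      ← map_smul, Module.AEval'.X_smul_of]
  let b := (Pi.basis c).map T.symm
  have hTb : ∀ i j, T (b ⟨i, j⟩) = Pi.single i (c i j) := fun i j ↦ by simp [b]
  refine ⟨ι, inferInstance, d, b, fun i j h ↦ T.injective ?_, fun i j k l hk ↦ ?_⟩
  · rw [hT, hTb, hTb, ← Pi.single_smul, hc i j h]
  · have : b.repr (f (b ⟨i, j⟩)) ⟨k, l⟩ = (c k).repr (T (f (b ⟨i, j⟩)) k) l := by
      simp [b]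
    rw [this, hT, hTb, ← Pi.single_smul, Pi.single_eq_of_ne hk, map_zero, Finsupp.zero_apply]

theorem card_toMatrix_ne_zero_le {F V ι : Type*} [Field F] [DecidableEq F] [AddCommGroup V]
    [Module F V] [Fintype ι] [DecidableEq ι] {d : ι → ℕ} (f : Module.End F V)
    (b : Module.Basis (Σ i, Fin (d i)) F V) [Nonempty (Σ i, Fin (d i))]
    (hsucc : ∀ i (j : Fin (d i)) (h : j.1 + 1 < d i), f (b ⟨i, j⟩) = b ⟨i, j.1 + 1, h⟩)
    (hblock : ∀ i (j : Fin (d i)) k (l : Fin (d k)), k ≠ i →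
      b.repr (f (b ⟨i, j⟩)) ⟨k, l⟩ = 0) :
    (Finset.univ.filter fun q : (Σ i, Fin (d i)) × (Σ i, Fin (d i)) ↦
      LinearMap.toMatrix b b f q.1 q.2 ≠ 0).card ≤ 2 * Fintype.card (Σ i, Fin (d i)) - 1 := by
  have hcol : ∀ i (j : Fin (d i)),
      (Finset.univ.filter fun r ↦ LinearMap.toMatrix b b f r ⟨i, j⟩ ≠ 0).card ≤
        if j.1 + 1 = d i then d i else 1 := by
    intro i j
    simp only [LinearMap.toMatrix_apply]
    split_ifs with h
    · calc
        _ ≤ (Finset.univ.image fun l : Fin (d i) ↦ (⟨i, l⟩ : Σ i, Fin (d i))).card := by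
          refine Finset.card_le_card fun ⟨k, l⟩ hr ↦ ?_
          rw [Finset.mem_filter] at hr
          by_cases hk : k = i
          · subst hk
            exact Finset.mem_image_of_mem _ (Finset.mem_univ l)
          · exact absurd (hblock i j k l hk) hr.2
        _ ≤ _ := Finset.card_image_le.trans (by simp)
    · rw [hsucc i j (by omega), Finset.card_le_one]
      simp +contextual [Finsupp.single_apply]
  have hsum : ∀ i, ∑ j : Fin (d i), (if j.1 + 1 = d i then d i else 1) = 2 * d i - 1 := by
    intro i
    cases d i with
    | zero => rfl
    | succ m =>
      rw [Fin.sum_univ_castSucc, Finset.sum_congr rfl fun j _ ↦ if_neg (by simp; omega)]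
      simp
      omega
  obtain ⟨i₀, j₀⟩ := ‹Nonempty (Σ i, Fin (d i))›
  have hlt : ∑ i, (2 * d i - 1) < ∑ i, 2 * d i :=
    Finset.sum_lt_sum (fun _ _ ↦ Nat.sub_le _ _) ⟨i₀, Finset.mem_univ _, by have := j₀.2; omega⟩
  calc
    _ = ∑ q : Σ i, Fin (d i),
        (Finset.univ.filter fun r ↦ LinearMap.toMatrix b b f r q ≠ 0).card := by
      simp only [Finset.card_filter, Fintype.sum_prod_type_right]
    _ ≤ ∑ q : Σ i, Fin (d i), if q.2.1 + 1 = d q.1 then d q.1 else 1 :=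
      Finset.sum_le_sum fun q _ ↦ hcol q.1 q.2
    _ = ∑ i, (2 * d i - 1) := by rw [Fintype.sum_sigma, Finset.sum_congr rfl fun i _ ↦ hsum i]
    _ ≤ _ := by
      rw [Fintype.card_sigma]
      simp only [Fintype.card_fin, ← Finset.mul_sum] at hlt ⊢
      omega

/-- **Every square matrix over a field is similar to a sparse matrix.** For every `n ≥ 1` and
every `n × n` matrix `A` over a field `F`, there is an invertible matrix `S` such that
`S * A * S⁻¹` has at most `2n - 1` nonzero entries. -/
theorem similar_to_sparse {F : Type*} [Field F] [DecidableEq F] (n : ℕ) (hn : 1 ≤ n)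
    (A : Matrix (Fin n) (Fin n) F) :
    ∃ S : Matrix (Fin n) (Fin n) F, IsUnit S ∧
      (Finset.univ.filter fun p : Fin n × Fin n => (S * A * S⁻¹) p.1 p.2 ≠ 0).card
        ≤ 2 * n - 1 := by
  classical
  obtain ⟨ι, _, d, b, hsucc, hblock⟩ := exists_basis_cyclic_decomposition (Matrix.toLin' A)
  have hcard : Fintype.card (Σ i, Fin (d i)) = n := by
    rw [← Module.finrank_eq_card_basis b, Module.finrank_fin_fun]
  have : Nonempty (Σ i, Fin (d i)) := Fintype.card_pos_iff.mp (by omega)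
  let σ : (Σ i, Fin (d i)) ≃ Fin n := Fintype.equivFinOfCardEq hcard
  let b' := b.reindex σ
  let e := Pi.basisFun F (Fin n)
  have hinv : (b'.toMatrix e)⁻¹ = e.toMatrix b' :=
    Matrix.inv_eq_right_inv (b'.toMatrix_mul_toMatrix_flip e)
  have hS : b'.toMatrix e * A * (b'.toMatrix e)⁻¹ =
      LinearMap.toMatrix b' b' (Matrix.toLin' A) := by
    have hA : LinearMap.toMatrix e e (Matrix.toLin' A) = A := LinearMap.toMatrix'_toLin' A
    rw [hinv, ← basis_toMatrix_mul_linearMap_toMatrix_mul_basis_toMatrix b' e b' e, hA]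
  refine ⟨b'.toMatrix e, @isUnit_of_invertible _ _ _ (b'.invertibleToMatrix e), ?_⟩
  rw [hS]
  have hle := card_toMatrix_ne_zero_le (Matrix.toLin' A) b hsucc hblock
  rw [hcard] at hle
  refine le_trans (le_of_eq ?_) hle
  refine Finset.card_equiv (σ.symm.prodCongr σ.symm) fun q ↦ ?_
  simp [b', LinearMap.toMatrix_apply]
end

section
/- Let F be a field, λ ∈ F, and let A be an n×n matrix over F that is similar to the block-diagonal matrix of companion matrices of monic polynomials f₁, …, f_k over F, each of the form qᵐ with q monic irreducible and m ≥ 1. Then the dimension of the eigenspace ker(A − λI) equals the number of indices i such that (x − λ) divides fᵢ. -/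
open Polynomial Matrix

theorem Matrix.finrank_ker_toLin'_add_rank {F ι : Type*} [Field F] [Fintype ι] [DecidableEq ι]
    (M : Matrix ι ι F) :
    Module.finrank F (LinearMap.ker (Matrix.toLin' M)) + M.rank = Fintype.card ι := by
  rw [add_comm, ← Module.finrank_fintype_fun_eq_card F]
  exact LinearMap.finrank_range_add_finrank_ker (Matrix.toLin' M)

theorem Matrix.finrank_ker_toLin'_transpose {F ι : Type*} [Field F] [Fintype ι] [DecidableEq ι]
    (M : Matrix ι ι F) :
    Module.finrank F (LinearMap.ker (Matrix.toLin' Mᵀ)) =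
      Module.finrank F (LinearMap.ker (Matrix.toLin' M)) := by
  have h := M.finrank_ker_toLin'_add_rank
  have h' := Mᵀ.finrank_ker_toLin'_add_rank
  rw [Matrix.rank_transpose] at h'
  omega

theorem Matrix.blockDiagonal'_mulVec_apply_s7 {R ι : Type*} [Semiring R] [Fintype ι] [DecidableEq ι]
    {α β : ι → Type*} [∀ i, Fintype (β i)] (M : ∀ i, Matrix (α i) (β i) R)
    (v : (Σ i, β i) → R) (i : ι) (a : α i) :
    (Matrix.blockDiagonal' M *ᵥ v) ⟨i, a⟩ = (M i *ᵥ fun b => v ⟨i, b⟩) a := by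
  simp only [Matrix.mulVec, dotProduct, Fintype.sum_sigma]
  rw [Finset.sum_eq_single i]
  · simp [Matrix.blockDiagonal'_apply_eq]
  · intro j _ hj
    exact Finset.sum_eq_zero fun b _ => by
      rw [Matrix.blockDiagonal'_apply_ne _ _ _ hj.symm, zero_mul]
  · simp

/-- The kernel of a block diagonal matrix is the product of the kernels of its blocks. -/
def Matrix.kerBlockDiagonalEquiv {F ι : Type*} [Field F] [Fintype ι] [DecidableEq ι]
    {β : ι → Type*} [∀ i, Fintype (β i)] [∀ i, DecidableEq (β i)]
    (M : ∀ i, Matrix (β i) (β i) F) :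
    LinearMap.ker (Matrix.toLin' (Matrix.blockDiagonal' M)) ≃ₗ[F]
      ∀ i, LinearMap.ker (Matrix.toLin' (M i)) where
  toFun v i := ⟨fun b => v.1 ⟨i, b⟩, by
    ext b
    rw [Matrix.toLin'_apply, ← Matrix.blockDiagonal'_mulVec_apply_s7 M v.1]
    exact congrFun v.2 ⟨i, b⟩⟩
  map_add' _ _ := rfl
  map_smul' _ _ := rfl
  invFun w := ⟨fun p => (w p.1).1 p.2, by
    ext ⟨i, b⟩
    rw [Matrix.toLin'_apply, Matrix.blockDiagonal'_mulVec_apply_s7]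
    exact congrFun (w i).2 b⟩
  left_inv _ := rfl
  right_inv _ := rfl

theorem companionMatrix_sub_smul_transpose_mulVec_eq_zero_iff {F : Type*} [Field F] {m : ℕ}
    {f : F[X]} (hf : f.Monic) (hd : f.natDegree = m + 1) (μ : F) (v : Fin (m + 1) → F) :
    (companionMatrix (m + 1) f - μ • (1 : Matrix (Fin (m + 1)) (Fin (m + 1)) F))ᵀ *ᵥ v = 0 ↔
      (v = v 0 • fun j : Fin (m + 1) => μ ^ (j : ℕ)) ∧ v 0 * f.eval μ = 0 := by
  have entry (j : Fin (m + 1)) :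
      ((companionMatrix (m + 1) f - μ • (1 : Matrix (Fin (m + 1)) (Fin (m + 1)) F))ᵀ *ᵥ v) j =
        (∑ i, companionMatrix (m + 1) f i j * v i) - μ * v j := by
    simp [Matrix.mulVec, dotProduct, Matrix.one_apply, sub_mul, Finset.sum_sub_distrib]
  have entry_castSucc (j : Fin m) :
      ∑ i, companionMatrix (m + 1) f i j.castSucc * v i = v j.succ := by
    rw [Finset.sum_eq_single j.succ]
    · simp [companionMatrix]
    · intro i _ hi
      have h₁ : (i : ℕ) ≠ j + 1 := fun h => hi (Fin.ext h)
      simp [companionMatrix, h₁, j.2.ne]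
    · simp
  have entry_last : ∑ i, companionMatrix (m + 1) f i (Fin.last m) * v i =
      -∑ i : Fin (m + 1), f.coeff i * v i := by
    rw [← Finset.sum_neg_distrib]
    refine Finset.sum_congr rfl fun i _ => ?_
    simp [companionMatrix, i.2.ne]
  have eval_eq : f.eval μ = ∑ i : Fin (m + 1), f.coeff i * μ ^ (i : ℕ) + μ ^ (m + 1) := by
    have h := hf.coeff_natDegree
    rw [hd] at h
    rw [eval_eq_sum_range, hd, Finset.sum_range_succ, h, one_mul,
      Finset.sum_range fun i => f.coeff i * μ ^ i]
  have last_eq (c : F) : (-∑ i : Fin (m + 1), f.coeff i * (c * μ ^ (i : ℕ))) - μ * (c * μ ^ m) =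
      -(c * f.eval μ) := by
    simp_rw [mul_left_comm _ c, ← Finset.mul_sum, eval_eq]
    ring
  constructor
  · intro h
    have rec_eq (j : Fin m) : v j.succ = μ * v j.castSucc := by
      have := congrFun h j.castSucc
      rwa [entry, entry_castSucc, Pi.zero_apply, sub_eq_zero] at this
    have hv (j : Fin (m + 1)) : v j = v 0 * μ ^ (j : ℕ) := by
      induction j using Fin.induction with
      | zero => simp
      | succ j ih =>
        rw [rec_eq, ih, Fin.val_succ, Fin.val_castSucc]
        ring
    refine ⟨funext hv, ?_⟩
    have := congrFun h (Fin.last m)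
    rw [entry, entry_last, hv (Fin.last m), Finset.sum_congr rfl fun i _ => by rw [hv i],
      Fin.val_last, last_eq] at this
    exact neg_eq_zero.mp this
  · rintro ⟨hv, h0⟩
    have hv (j : Fin (m + 1)) : v j = v 0 * μ ^ (j : ℕ) := congrFun hv j
    ext j
    rw [entry]
    induction j using Fin.lastCases with
    | last =>
      rw [entry_last, hv (Fin.last m), Finset.sum_congr rfl fun i _ => by rw [hv i],
        Fin.val_last, last_eq, h0, neg_zero, Pi.zero_apply]
    | cast j =>
      rw [entry_castSucc, hv j.succ, hv j.castSucc, Fin.val_succ, Fin.val_castSucc,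
        Pi.zero_apply]
      ring

open Classical in
/-- The eigenspace of a companion matrix is a line at the roots of the polynomial, and trivial
elsewhere. -/
theorem finrank_ker_companionMatrix_sub_smul {F : Type*} [Field F] {d : ℕ} {f : F[X]}
    (hf : f.Monic) (hd : f.natDegree = d) (μ : F) :
    Module.finrank F (LinearMap.ker (Matrix.toLin'
        (companionMatrix d f - μ • (1 : Matrix (Fin d) (Fin d) F)))) =
      if (X - C μ) ∣ f then 1 else 0 := by
  rw [dvd_iff_isRoot]
  obtain _ | m := d
  · rw [hf.natDegree_eq_zero] at hd
    simp [hd, Module.finrank_zero_of_subsingleton]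
  rw [← Matrix.finrank_ker_toLin'_transpose]
  set w : Fin (m + 1) → F := fun j => μ ^ (j : ℕ) with hw
  have hw0 : w 0 = 1 := by simp [hw]
  split_ifs with h
  · have hker : LinearMap.ker (Matrix.toLin'
        (companionMatrix (m + 1) f - μ • (1 : Matrix (Fin (m + 1)) (Fin (m + 1)) F))ᵀ) =
        Submodule.span F {w} := by
      ext v
      rw [LinearMap.mem_ker, Matrix.toLin'_apply,
        companionMatrix_sub_smul_transpose_mulVec_eq_zero_iff hf hd, h.eq_zero, mul_zero,
        Submodule.mem_span_singleton]
      constructor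
      · rintro ⟨hv, -⟩
        exact ⟨v 0, hv.symm⟩
      · rintro ⟨c, rfl⟩
        simp [hw]
    rw [hker]
    exact finrank_span_singleton fun h0 => by simp [h0] at hw0
  · have hker : LinearMap.ker (Matrix.toLin'
        (companionMatrix (m + 1) f - μ • (1 : Matrix (Fin (m + 1)) (Fin (m + 1)) F))ᵀ) = ⊥ := by
      rw [eq_bot_iff]
      intro v hv
      rw [LinearMap.mem_ker, Matrix.toLin'_apply,
        companionMatrix_sub_smul_transpose_mulVec_eq_zero_iff hf hd] at hv
      obtain ⟨hv, h0⟩ := hv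
      rw [Submodule.mem_bot, hv, (mul_eq_zero.mp h0).resolve_right h, zero_smul]
    rw [hker, finrank_bot]

theorem Matrix.rank_conj_reindex_sub_smul {F ι κ : Type*} [Field F] [Fintype ι] [DecidableEq ι]
    [Fintype κ] [DecidableEq κ] (e : κ ≃ ι) {S : Matrix ι ι F} (hS : IsUnit S)
    (B : Matrix κ κ F) (μ : F) :
    (S * Matrix.reindex e e B * S⁻¹ - μ • (1 : Matrix ι ι F)).rank =
      (B - μ • (1 : Matrix κ κ F)).rank := by
  have hdet : IsUnit S.det := (Matrix.isUnit_iff_isUnit_det S).mp hS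
  have hconj : S * Matrix.reindex e e B * S⁻¹ - μ • (1 : Matrix ι ι F) =
      S * Matrix.reindex e e (B - μ • (1 : Matrix κ κ F)) * S⁻¹ := by
    have hre : Matrix.reindex e e (B - μ • (1 : Matrix κ κ F)) =
        Matrix.reindex e e B - μ • (1 : Matrix ι ι F) := by
      ext i j
      simp [Matrix.one_apply]
    rw [hre, Matrix.mul_sub, Matrix.sub_mul, Matrix.mul_smul, Matrix.smul_mul, Matrix.mul_one,
      Matrix.mul_nonsing_inv _ hdet]
  rw [hconj, Matrix.rank_mul_eq_left_of_isUnit_det _ _ (Matrix.isUnit_nonsing_inv_det _ hdet),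
    Matrix.rank_mul_eq_right_of_isUnit_det _ _ hdet, Matrix.rank_reindex]

/-- If `A` is similar to the block diagonal of the companion matrices of the prime-power
monic polynomials `f i`, then for any scalar `μ` the dimension of the eigenspace
`ker (A - μ • I)` equals the number of indices `i` with `(x - μ) ∣ f i`. -/
theorem eigenspace_dim_eq_card_blocks {F : Type*} [Field F] (n : ℕ) (μ : F)
    (A : Matrix (Fin n) (Fin n) F)
    {k : ℕ} (d : Fin k → ℕ) (f : Fin k → Polynomial F)
    (hf : ∀ i, (f i).Monic ∧ (f i).natDegree = d i ∧
      ∃ (q : Polynomial F) (m : ℕ), q.Monic ∧ Irreducible q ∧ 1 ≤ m ∧ f i = q ^ m)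
    (hA : ∃ (e : (Σ i : Fin k, Fin (d i)) ≃ Fin n) (S : Matrix (Fin n) (Fin n) F),
      IsUnit S ∧
      A = S * Matrix.reindex e e (Matrix.blockDiagonal' fun i => companionMatrix (d i) (f i))
            * S⁻¹) :
    Module.finrank F
        (LinearMap.ker (Matrix.toLin' (A - μ • (1 : Matrix (Fin n) (Fin n) F))))
      = Nat.card {i : Fin k // (X - C μ) ∣ f i} := by
  classical
  obtain ⟨e, S, hS, rfl⟩ := hA
  have hrank := Matrix.rank_conj_reindex_sub_smul e hS
    (Matrix.blockDiagonal' fun i => companionMatrix (d i) (f i)) μ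
  have hblock : (Matrix.blockDiagonal' fun i => companionMatrix (d i) (f i)) -
      μ • (1 : Matrix (Σ i, Fin (d i)) (Σ i, Fin (d i)) F) =
      Matrix.blockDiagonal' fun i =>
        companionMatrix (d i) (f i) - μ • (1 : Matrix (Fin (d i)) (Fin (d i)) F) := by
    rw [← Matrix.blockDiagonal'_one, ← Matrix.blockDiagonal'_smul, ← Matrix.blockDiagonal'_sub]
    rfl
  have hker := (Matrix.kerBlockDiagonalEquiv fun i =>
    companionMatrix (d i) (f i) - μ • (1 : Matrix (Fin (d i)) (Fin (d i)) F)).finrank_eq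
  rw [← hblock, Module.finrank_pi_fintype, Finset.sum_congr rfl fun i _ =>
    finrank_ker_companionMatrix_sub_smul (hf i).1 (hf i).2.1 μ] at hker
  rw [Nat.card_eq_fintype_card, Fintype.card_subtype, Finset.card_filter, ← hker]
  have h₁ := Matrix.finrank_ker_toLin'_add_rank (S * Matrix.reindex e e
    (Matrix.blockDiagonal' fun i => companionMatrix (d i) (f i)) * S⁻¹ -
      μ • (1 : Matrix (Fin n) (Fin n) F))
  have h₂ := Matrix.finrank_ker_toLin'_add_rank
    ((Matrix.blockDiagonal' fun i => companionMatrix (d i) (f i)) -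
      μ • (1 : Matrix (Σ i, Fin (d i)) (Σ i, Fin (d i)) F))
  rw [hrank, ← Fintype.card_congr e] at h₁
  exact Nat.add_right_cancel (h₁.trans h₂.symm)
end

section
/- Let n ≥ 1 and let A be an n×n matrix over 𝔽₂ such that A^(2^k) = I for some natural number k. Then A^(2^⌈log₂ n⌉) = I. In particular, if the multiplicative order of A is exactly 2^k, then k ≤ ⌈log₂ n⌉. -/
open Matrix

theorem Matrix.pow_card_eq_zero_of_isNilpotent {ι R : Type*} [Fintype ι] [DecidableEq ι]
    [CommRing R] [IsDomain R] {M : Matrix ι ι R} (hM : IsNilpotent M) :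
    M ^ Fintype.card ι = 0 := by
  have hchar : M.charpoly = Polynomial.X ^ Fintype.card ι :=
    sub_eq_zero.mp (Matrix.isNilpotent_charpoly_sub_pow_of_isNilpotent hM).eq_zero
  simpa [hchar] using Matrix.aeval_self_charpoly M

/-- If an `n × n` matrix `A` over `𝔽₂` (with `n ≥ 1`) satisfies `A^(2^k) = I` for some `k`,
then already `A^(2^⌈log₂ n⌉) = I`; in particular, if the multiplicative order of `A` is
exactly `2^k`, then `k ≤ ⌈log₂ n⌉`. -/
theorem pow_two_pow_clog_eq_one (n : ℕ) (hn : 1 ≤ n) (A : Matrix (Fin n) (Fin n) (ZMod 2))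
    (k : ℕ) (h : A ^ (2 ^ k) = 1) :
    A ^ (2 ^ Nat.clog 2 n) = 1 ∧ (orderOf A = 2 ^ k → k ≤ Nat.clog 2 n) := by
  have : NeZero n := ⟨by omega⟩
  have sub_one_pow (m : ℕ) : (A - 1) ^ 2 ^ m = A ^ 2 ^ m - 1 := by
    simpa using sub_pow_char_pow_of_commute 2 m (Commute.one_right A)
  have hnil : IsNilpotent (A - 1) := ⟨2 ^ k, by rw [sub_one_pow, h, sub_self]⟩
  have hpow : A ^ 2 ^ Nat.clog 2 n = 1 := by
    rw [← sub_eq_zero, ← sub_one_pow]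
    refine pow_eq_zero_of_le (Nat.le_pow_clog one_lt_two n) ?_
    simpa using Matrix.pow_card_eq_zero_of_isNilpotent hnil
  refine ⟨hpow, fun hord => ?_⟩
  rw [← Nat.pow_dvd_pow_iff_le_right one_lt_two, ← hord]
  exact orderOf_dvd_of_pow_eq_one hpow
end
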